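/- Let n ≥ 2 and let B be a finite abstract q_n-crystal. Then the character ch(B) := Σ_{b∈B} x_1^{wt(b)_1} x_2^{wt(b)_2} ⋯ x_n^{wt(b)_n} is a symmetric polynomial in x_1,…,x_n, and it is supersymmetric: the substitution x_2 = −x_1 yields ch(B)(x_1, −x_1, x_3, …, x_n) ∈ ℤ[x_3,…,x_n]. -/

import Mathlib

namespace Paper

/-- `g` applied `k` times to `b`, in `B ⊔ {0}` (with `g(0) = 0`). -/
def iterOpt {B : Type*} (g : B → Option B) (k : ℕ) (b : B) : Option B :=
  (fun o => o.bind g)^[k] (some b)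

/-- An abstract `q_n`-crystal: an abstract `gl_n`-crystal (weight map, crystal
operators `e_i, f_i` for `1 ≤ i ≤ n-1` and string lengths `ε_i, φ_i`)
together with queer operators `e_1̄, f_1̄`.  Weights are indexed by the
coordinates `1, …, n` (the map `wt` vanishes outside this range). -/
structure QnCrystal (n : ℕ) (B : Type*) where
  /-- the weight map, with coordinates indexed by `1, …, n` -/
  wt : B → ℕ → ℕ
  wt_out : ∀ b j, j = 0 ∨ n < j → wt b j = 0
  /-- raising operators `e_i` for `1 ≤ i ≤ n - 1` -/
  e : ℕ → B → Option B
  /-- lowering operators `f_i` for `1 ≤ i ≤ n - 1` -/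
  f : ℕ → B → Option B
  /-- the queer raising operator `e_1̄` -/
  ebar : B → Option B
  /-- the queer lowering operator `f_1̄` -/
  fbar : B → Option B
  /-- string lengths `ε_i` -/
  eps : ℕ → B → ℕ
  /-- string lengths `φ_i` -/
  phi : ℕ → B → ℕ
  /-- `ε_1̄` -/
  epsbar : B → ℕ
  /-- `φ_1̄` -/
  phibar : B → ℕ
  ef_iff : ∀ i, 1 ≤ i → i ≤ n - 1 → ∀ b c, (e i b = some c ↔ f i c = some b)
  wt_e : ∀ i, 1 ≤ i → i ≤ n - 1 → ∀ b c, e i b = some c →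
    wt c i = wt b i + 1 ∧ wt b (i + 1) = wt c (i + 1) + 1 ∧
      ∀ j, j ≠ i → j ≠ i + 1 → wt c j = wt b j
  eps_spec : ∀ i, 1 ≤ i → i ≤ n - 1 → ∀ b,
    iterOpt (e i) (eps i b) b ≠ none ∧ iterOpt (e i) (eps i b + 1) b = none
  phi_spec : ∀ i, 1 ≤ i → i ≤ n - 1 → ∀ b,
    iterOpt (f i) (phi i b) b ≠ none ∧ iterOpt (f i) (phi i b + 1) b = none
  string_eq : ∀ i, 1 ≤ i → i ≤ n - 1 → ∀ b,
    (phi i b : ℤ) - (eps i b : ℤ) = (wt b i : ℤ) - (wt b (i + 1) : ℤ)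
  ebar_fbar_iff : ∀ b c, (ebar b = some c ↔ fbar c = some b)
  wt_ebar : ∀ b c, ebar b = some c →
    (wt c 1 = wt b 1 + 1 ∧ wt b 2 = wt c 2 + 1 ∧ ∀ j, j ≠ 1 → j ≠ 2 → wt c j = wt b j) ∧
    ∀ i, 3 ≤ i → i ≤ n - 1 → eps i b = eps i c ∧ phi i b = phi i c
  comm_bar : ∀ i, 3 ≤ i → i ≤ n - 1 → ∀ b,
    (ebar b).bind (e i) = (e i b).bind ebar ∧
    (ebar b).bind (f i) = (f i b).bind ebar ∧
    (fbar b).bind (e i) = (e i b).bind fbar ∧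
    (fbar b).bind (f i) = (f i b).bind fbar
  epsbar_spec : ∀ b, iterOpt ebar (epsbar b) b ≠ none ∧ iterOpt ebar (epsbar b + 1) b = none
  phibar_spec : ∀ b, iterOpt fbar (phibar b) b ≠ none ∧ iterOpt fbar (phibar b + 1) b = none
  queer3 : ∀ b, epsbar b + phibar b ≤ 1 ∧
    ((wt b 1 ≠ 0 ∨ wt b 2 ≠ 0) → epsbar b + phibar b = 1)

/-- The character `ch(B) = Σ_{b ∈ B} x_1^{wt(b)_1} ⋯ x_n^{wt(b)_n}`. -/
noncomputable def qCharacter (n : ℕ) {B : Type*} [Fintype B] (C : QnCrystal n B) :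
    MvPolynomial (Fin n) ℤ :=
  ∑ b : B, ∏ j : Fin n, (MvPolynomial.X j : MvPolynomial (Fin n) ℤ) ^ C.wt b ((j : ℕ) + 1)

theorem iterOpt_succ {B : Type*} (g : B → Option B) (k : ℕ) (b : B) :
    iterOpt g (k + 1) b = (iterOpt g k b).bind g := by
  unfold iterOpt
  rw [Function.iterate_succ_apply']

theorem iterOpt_succ_some {B : Type*} (g : B → Option B) (k : ℕ) (b c : B) (h : g b = some c) :
    iterOpt g (k + 1) b = iterOpt g k c := by
  unfold iterOpt
  rw [Function.iterate_succ_apply]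
  simp [h]

theorem iterOpt_one {B : Type*} (g : B → Option B) (b : B) : iterOpt g 1 b = g b := by
  simp [iterOpt]

theorem iterOpt_inv {B : Type*} (e f : B → Option B)
    (h : ∀ b c, e b = some c → f c = some b) (k : ℕ) :
    ∀ b c, iterOpt e k b = some c → iterOpt f k c = some b := by
  induction k with
  | zero =>
    intro b c hc
    simp [iterOpt] at hc ⊢
    exact hc.symm
  | succ k ih =>
    intro b c hc
    rw [iterOpt_succ, Option.bind_eq_some_iff] at hc
    obtain ⟨d, hd, hdc⟩ := hc
    rw [iterOpt_succ_some f k c d (h d c hdc)]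
    exact ih b d hd

theorem iterOpt_ne_none {B : Type*} (g : B → Option B) (b : B) (k l : ℕ)
    (h : iterOpt g (k + l) b ≠ none) : iterOpt g k b ≠ none := by
  induction l with
  | zero => exact h
  | succ l ih =>
    apply ih
    intro h0
    apply h
    rw [← add_assoc, iterOpt_succ, h0]
    rfl

theorem wt_iter {n : ℕ} {B : Type*} (C : QnCrystal n B) (i : ℕ) (h1 : 1 ≤ i) (h2 : i ≤ n - 1)
    (k : ℕ) : ∀ b c, iterOpt (C.e i) k b = some c →
      C.wt c i = C.wt b i + k ∧ C.wt b (i + 1) = C.wt c (i + 1) + k ∧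
      ∀ j, j ≠ i → j ≠ i + 1 → C.wt c j = C.wt b j := by
  induction k with
  | zero =>
    intro b c hc
    simp [iterOpt] at hc
    subst hc
    simp
  | succ k ih =>
    intro b c hc
    rw [iterOpt_succ, Option.bind_eq_some_iff] at hc
    obtain ⟨d, hd, hdc⟩ := hc
    obtain ⟨a1, a2, a3⟩ := ih b d hd
    obtain ⟨b1, b2, b3⟩ := C.wt_e i h1 h2 d c hdc
    refine ⟨by omega, by omega, fun j hj hj' => ?_⟩
    rw [b3 j hj hj', a3 j hj hj']

/-- The reflection along an `i`-string, as a relation. -/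
def Refl {n : ℕ} {B : Type*} (C : QnCrystal n B) (i : ℕ) (b c : B) : Prop :=
  (C.wt b (i + 1) ≤ C.wt b i → iterOpt (C.f i) (C.wt b i - C.wt b (i + 1)) b = some c) ∧
  (C.wt b i ≤ C.wt b (i + 1) → iterOpt (C.e i) (C.wt b (i + 1) - C.wt b i) b = some c)

theorem refl_exists {n : ℕ} {B : Type*} (C : QnCrystal n B) (i : ℕ) (h1 : 1 ≤ i)
    (h2 : i ≤ n - 1) (b : B) : ∃ c, Refl C i b c := by
  have hs := C.string_eq i h1 h2 b
  rcases lt_trichotomy (C.wt b (i + 1)) (C.wt b i) with h | h | h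
  · have hp := (C.phi_spec i h1 h2 b).1
    have : C.phi i b = (C.wt b i - C.wt b (i + 1)) + C.eps i b := by omega
    rw [this] at hp
    obtain ⟨c, hc⟩ := Option.ne_none_iff_exists'.1 (iterOpt_ne_none _ _ _ _ hp)
    exact ⟨c, fun _ => hc, fun h' => by omega⟩
  · refine ⟨b, fun _ => ?_, fun _ => ?_⟩ <;> simp [h, iterOpt]
  · have hp := (C.eps_spec i h1 h2 b).1
    have : C.eps i b = (C.wt b (i + 1) - C.wt b i) + C.phi i b := by omega
    rw [this] at hp
    obtain ⟨c, hc⟩ := Option.ne_none_iff_exists'.1 (iterOpt_ne_none _ _ _ _ hp)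
    exact ⟨c, fun h' => by omega, fun _ => hc⟩

theorem refl_unique {n : ℕ} {B : Type*} (C : QnCrystal n B) (i : ℕ) (b c d : B)
    (hc : Refl C i b c) (hd : Refl C i b d) : c = d := by
  rcases le_total (C.wt b (i + 1)) (C.wt b i) with h | h
  · exact Option.some.inj ((hc.1 h).symm.trans (hd.1 h))
  · exact Option.some.inj ((hc.2 h).symm.trans (hd.2 h))

theorem refl_wt {n : ℕ} {B : Type*} (C : QnCrystal n B) (i : ℕ) (h1 : 1 ≤ i)
    (h2 : i ≤ n - 1) (b c : B) (h : Refl C i b c) :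
    C.wt c i = C.wt b (i + 1) ∧ C.wt c (i + 1) = C.wt b i ∧
      ∀ j, j ≠ i → j ≠ i + 1 → C.wt c j = C.wt b j := by
  rcases le_total (C.wt b (i + 1)) (C.wt b i) with hl | hl
  · have := iterOpt_inv _ _ (fun b c => (C.ef_iff i h1 h2 c b).2) _ _ _ (h.1 hl)
    obtain ⟨a1, a2, a3⟩ := wt_iter C i h1 h2 _ _ _ this
    exact ⟨by omega, by omega, fun j hj hj' => (a3 j hj hj').symm⟩
  · obtain ⟨a1, a2, a3⟩ := wt_iter C i h1 h2 _ _ _ (h.2 hl)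
    exact ⟨by omega, by omega, a3⟩

theorem refl_symm {n : ℕ} {B : Type*} (C : QnCrystal n B) (i : ℕ) (h1 : 1 ≤ i)
    (h2 : i ≤ n - 1) (b c : B) (h : Refl C i b c) : Refl C i c b := by
  obtain ⟨w1, w2, -⟩ := refl_wt C i h1 h2 b c h
  refine ⟨fun hl => ?_, fun hl => ?_⟩
  · rw [w1, w2] at hl ⊢
    exact iterOpt_inv _ _ (fun b c => (C.ef_iff i h1 h2 b c).1) _ _ _ (h.2 hl)
  · rw [w1, w2] at hl ⊢
    exact iterOpt_inv _ _ (fun b c => (C.ef_iff i h1 h2 c b).2) _ _ _ (h.1 hl)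

theorem rename_swap {m : ℕ} {B : Type*} [Fintype B] (C : QnCrystal (m + 1) B) (i : Fin m) :
    MvPolynomial.rename (Equiv.swap i.castSucc i.succ) (qCharacter (m + 1) C) =
      qCharacter (m + 1) C := by
  have h1 : 1 ≤ (i : ℕ) + 1 := by omega
  have h2 : (i : ℕ) + 1 ≤ m + 1 - 1 := by omega
  choose T hT using refl_exists C ((i : ℕ) + 1) h1 h2
  have hinv : Function.Involutive T := fun b =>
    refl_unique C _ _ _ _ (hT (T b)) (refl_symm C _ h1 h2 _ _ (hT b))
  unfold qCharacter
  rw [map_sum, ← Equiv.sum_comp hinv.toPerm]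
  refine Finset.sum_congr rfl fun b _ => ?_
  obtain ⟨w1, w2, w3⟩ := refl_wt C _ h1 h2 _ _ (hT b)
  rw [map_prod, ← Equiv.prod_comp (Equiv.swap i.castSucc i.succ)]
  refine Finset.prod_congr rfl fun j _ => ?_
  simp only [map_pow, MvPolynomial.rename_X, Equiv.swap_apply_self, Function.Involutive.coe_toPerm]
  congr 1
  by_cases hj : j = i.castSucc
  · subst hj
    simpa using w2
  by_cases hj' : j = i.succ
  · subst hj'
    simpa using w1
  rw [Equiv.swap_apply_of_ne_of_ne hj hj']
  apply w3
  · intro h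
    exact hj (Fin.ext (by simpa using h))
  · intro h
    exact hj' (Fin.ext (by simpa using h))

theorem qChar_symm {m : ℕ} {B : Type*} [Fintype B] (C : QnCrystal (m + 1) B) :
    (qCharacter (m + 1) C).IsSymmetric := by
  intro σ
  have hσ : σ ∈ Submonoid.closure (Set.range fun i : Fin m => Equiv.swap i.castSucc i.succ) := by
    rw [Equiv.Perm.mclosure_swap_castSucc_succ]
    trivial
  induction hσ using Submonoid.closure_induction with
  | mem x hx =>
    obtain ⟨i, rfl⟩ := hx
    exact rename_swap C i
  | one => simp
  | mul x y _ _ hx hy =>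
    rw [Equiv.Perm.coe_mul, ← MvPolynomial.rename_rename, hy, hx]

theorem ebar_none {n : ℕ} {B : Type*} (C : QnCrystal n B) (b c : B) (h : C.fbar b = some c) :
    C.ebar b = none := by
  have hp : C.phibar b ≠ 0 := by
    intro h0
    have := (C.phibar_spec b).2
    rw [h0, zero_add, iterOpt_one, h] at this
    cases this
  have h3 := (C.queer3 b).1
  have he : C.epsbar b = 0 := by omega
  have := (C.epsbar_spec b).2
  rwa [he, zero_add, iterOpt_one] at this

theorem bar_exists {n : ℕ} {B : Type*} (C : QnCrystal n B) (b : B)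
    (hb : C.wt b 1 ≠ 0 ∨ C.wt b 2 ≠ 0) :
    (∃ c, C.ebar b = some c) ∨ (∃ c, C.fbar b = some c) := by
  have h3 := (C.queer3 b).2 hb
  have : C.epsbar b = 1 ∨ C.phibar b = 1 := by omega
  rcases this with h | h
  · left
    have := (C.epsbar_spec b).1
    rw [h, iterOpt_one] at this
    exact Option.ne_none_iff_exists'.1 this
  · right
    have := (C.phibar_spec b).1
    rw [h, iterOpt_one] at this
    exact Option.ne_none_iff_exists'.1 this

/-- The queer partner of `b`. -/
def partner {n : ℕ} {B : Type*} (C : QnCrystal n B) (b : B) : B :=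
  ((C.ebar b).or (C.fbar b)).getD b

theorem partner_spec {n : ℕ} {B : Type*} (C : QnCrystal n B) (b : B)
    (hb : C.wt b 1 ≠ 0 ∨ C.wt b 2 ≠ 0) :
    (C.ebar b = some (partner C b) ∨ C.ebar (partner C b) = some b) ∧
      partner C (partner C b) = b := by
  rcases bar_exists C b hb with ⟨c, hc⟩ | ⟨c, hc⟩
  · have hp : partner C b = c := by simp [partner, hc]
    have hf := (C.ebar_fbar_iff b c).1 hc
    rw [hp]
    exact ⟨Or.inl hc, by simp [partner, hf, ebar_none C c b hf]⟩
  · have hp : partner C b = c := by simp [partner, hc, ebar_none C b c hc]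
    have he := (C.ebar_fbar_iff c b).2 hc
    rw [hp]
    exact ⟨Or.inr he, by simp [partner, he]⟩

/-- The term of `b` in the specialised character. -/
noncomputable def term {m : ℕ} {B : Type*} (C : QnCrystal (m + 2) B) (b : B) :
    MvPolynomial (Fin (m + 2)) ℤ :=
  MvPolynomial.X 0 ^ C.wt b 1 * ((-MvPolynomial.X 0) ^ C.wt b 2 *
    ∏ j : Fin m, MvPolynomial.X j.succ.succ ^ C.wt b ((j : ℕ) + 3))

theorem term_cancel {m : ℕ} {B : Type*} (C : QnCrystal (m + 2) B) (b c : B)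
    (h : C.ebar b = some c) : term C b + term C c = 0 := by
  obtain ⟨w1, w2, w3⟩ := (C.wt_ebar b c h).1
  have : ∀ j : Fin m, C.wt c ((j : ℕ) + 3) = C.wt b ((j : ℕ) + 3) := fun j =>
    w3 _ (by omega) (by omega)
  simp only [term, this, w1, w2]
  ring

theorem qChar_super {m : ℕ} {B : Type*} [Fintype B] (C : QnCrystal (m + 2) B) :
    ∑ b, term C b ∈ MvPolynomial.supported ℤ {j : Fin (m + 2) | 2 ≤ (j : ℕ)} := by
  classical
  rw [← Finset.sum_filter_add_sum_filter_not Finset.univ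
    (fun b => C.wt b 1 ≠ 0 ∨ C.wt b 2 ≠ 0)]
  have hz : ∑ b ∈ Finset.univ.filter (fun b => C.wt b 1 ≠ 0 ∨ C.wt b 2 ≠ 0), term C b = 0 := by
    refine Finset.sum_involution (fun b _ => partner C b) ?_ ?_ ?_ ?_
    · intro b hb
      have hb' := (Finset.mem_filter.1 hb).2
      rcases (partner_spec C b hb').1 with h | h
      · exact term_cancel C _ _ h
      · exact (add_comm _ _).trans (term_cancel C _ _ h)
    · intro b hb _ heq
      have hb' := (Finset.mem_filter.1 hb).2
      rcases (partner_spec C b hb').1 with h | h <;>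
      · have := (C.wt_ebar _ _ h).1.1
        rw [heq] at this
        omega
    · intro b hb
      have hb' := (Finset.mem_filter.1 hb).2
      refine Finset.mem_filter.2 ⟨Finset.mem_univ _, ?_⟩
      rcases (partner_spec C b hb').1 with h | h
      · have := (C.wt_ebar _ _ h).1.1
        omega
      · have := (C.wt_ebar _ _ h).1.2.1
        omega
    · intro b hb
      exact (partner_spec C b (Finset.mem_filter.1 hb).2).2
  rw [hz, zero_add]
  refine Subalgebra.sum_mem _ fun b hb => ?_
  have hb' := (Finset.mem_filter.1 hb).2
  push Not at hb'
  rw [term, hb'.1, hb'.2, pow_zero, pow_zero, one_mul, one_mul]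
  refine Subalgebra.prod_mem _ fun j _ => Subalgebra.pow_mem _ ?_ _
  rw [MvPolynomial.X_mem_supported]
  simp

/-- The character of a finite abstract `q_n`-crystal (`n ≥ 2`) is a symmetric
polynomial, and it is supersymmetric: substituting `x_2 = -x_1` yields a
polynomial in `x_3, …, x_n` only. -/
theorem qCharacter_symmetric_and_supersymmetric
    (n : ℕ) (hn : 2 ≤ n) (B : Type*) [Fintype B] (C : QnCrystal n B) :
    (qCharacter n C).IsSymmetric ∧
    MvPolynomial.aeval
        (fun j : Fin n =>
          if (j : ℕ) = 1 then -(MvPolynomial.X (⟨0, by omega⟩ : Fin n))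
          else (MvPolynomial.X j : MvPolynomial (Fin n) ℤ))
        (qCharacter n C)
      ∈ MvPolynomial.supported ℤ {j : Fin n | 2 ≤ (j : ℕ)} := by
  obtain ⟨m, rfl⟩ : ∃ m, n = m + 2 := ⟨n - 2, by omega⟩
  refine ⟨qChar_symm C, ?_⟩
  convert qChar_super C using 1
  unfold qCharacter
  rw [map_sum]
  refine Finset.sum_congr rfl fun b _ => ?_
  rw [map_prod, Fin.prod_univ_succ, Fin.prod_univ_succ, term]
  simp


end Paper
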